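/- Let X be any of the vector fields ξ, R_i, S_i (1 ≤ i ≤ n), X_{ij} (1 ≤ i ≤ j ≤ n), Y_{ij} (1 ≤ i < j ≤ n). Then X leaves the contact form η^R invariant: for every smooth vector field Y on ℝ^{2n+1} and every point p, the directional derivative of the function q ↦ η^R_q(Y(q)) at p in the direction X(p) equals η^R_p([X,Y](p)); i.e. the Lie derivative £_X η^R vanishes, so X is an infinitesimal automorphism of the standard Sasakian structure on ℍ^{2n+1}. -/

import Mathlib

/-- The underlying space of the Heisenberg group `ℍ^{2n+1}`. -/
abbrev Heis (n : ℕ) : Type := (Fin n → ℝ) × (Fin n → ℝ) × ℝ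

/-- The Lie bracket of vector fields `[V,W](p) = DW(p)(V(p)) − DV(p)(W(p))`. -/
noncomputable def lieVF {n : ℕ} (V W : Heis n → Heis n) : Heis n → Heis n :=
  fun p => fderiv ℝ W p (V p) - fderiv ℝ V p (W p)

/-- The standard contact form `η^R_p(v) = v_z − Σ_i y_i v_{x_i}`. -/
def etaR {n : ℕ} (p v : Heis n) : ℝ := v.2.2 - ∑ i, p.2.1 i * v.1 i

/-- `ξ = ∂_z`. -/
def xiVF {n : ℕ} : Heis n → Heis n := fun _ => (0, 0, 1)

/-- `R_i = ∂_{x_i}`. -/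
def Rf {n : ℕ} (i : Fin n) : Heis n → Heis n := fun _ => (Pi.single i 1, 0, 0)

/-- `S_i = ∂_{y_i} + x_i ∂_z`. -/
def Sf {n : ℕ} (i : Fin n) : Heis n → Heis n := fun p => (0, Pi.single i 1, p.1 i)

/-- `X_{ij} = x_i∂_{y_j} + x_j∂_{y_i} − y_i∂_{x_j} − y_j∂_{x_i} + (x_ix_j − y_iy_j)∂_z`. -/
def Xf {n : ℕ} (i j : Fin n) : Heis n → Heis n := fun p =>
  (fun k => -(p.2.1 i * (if k = j then 1 else 0)) - p.2.1 j * (if k = i then 1 else 0),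
   fun k => p.1 i * (if k = j then 1 else 0) + p.1 j * (if k = i then 1 else 0),
   p.1 i * p.1 j - p.2.1 i * p.2.1 j)

/-- `Y_{ij} = x_i∂_{x_j} − x_j∂_{x_i} + y_i∂_{y_j} − y_j∂_{y_i}`. -/
def Yf {n : ℕ} (i j : Fin n) : Heis n → Heis n := fun p =>
  (fun k => p.1 i * (if k = j then 1 else 0) - p.1 j * (if k = i then 1 else 0),
   fun k => p.2.1 i * (if k = j then 1 else 0) - p.2.1 j * (if k = i then 1 else 0),
   0)

/-- The generators of the automorphism algebra of the standard Sasakian structure. -/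
def sasGens (n : ℕ) : Set (Heis n → Heis n) :=
  {xiVF} ∪ Set.range Rf ∪ Set.range Sf ∪
    {V | ∃ i j : Fin n, i ≤ j ∧ V = Xf i j} ∪
    {V | ∃ i j : Fin n, i < j ∧ V = Yf i j}

open ContinuousLinearMap in
theorem Heis.hasFDerivAt_x {n : ℕ} (i : Fin n) (p : Heis n) :
    HasFDerivAt (fun q : Heis n => q.1 i) ((proj i).comp (fst ℝ (Fin n → ℝ) _)) p :=
  ((proj i).comp (fst ℝ (Fin n → ℝ) ((Fin n → ℝ) × ℝ))).hasFDerivAt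

open ContinuousLinearMap in
theorem Heis.hasFDerivAt_y {n : ℕ} (i : Fin n) (p : Heis n) :
    HasFDerivAt (fun q : Heis n => q.2.1 i)
      ((proj i).comp ((fst ℝ (Fin n → ℝ) ℝ).comp (snd ℝ (Fin n → ℝ) _))) p :=
  ((proj i).comp ((fst ℝ (Fin n → ℝ) ℝ).comp
    (snd ℝ (Fin n → ℝ) ((Fin n → ℝ) × ℝ)))).hasFDerivAt

theorem fderiv_etaR_apply {n : ℕ} {Y : Heis n → Heis n} {p : Heis n}
    (hY : DifferentiableAt ℝ Y p) (v : Heis n) :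
    fderiv ℝ (fun q => etaR q (Y q)) p v =
      etaR p (fderiv ℝ Y p v) - ∑ i, v.2.1 i * (Y p).1 i := by
  have hx (i : Fin n) := (Heis.hasFDerivAt_x i (Y p)).comp p hY.hasFDerivAt
  have hsum := HasFDerivAt.fun_sum (u := Finset.univ)
    fun i _ => (Heis.hasFDerivAt_y i p).mul (hx i)
  have h : HasFDerivAt (fun q => etaR q (Y q)) _ p := hY.hasFDerivAt.snd.snd.sub hsum
  rw [h.fderiv]
  simp [etaR, Finset.sum_add_distrib, mul_comm]
  ring

/-- A vector field `X` satisfying `(£_X η^R)(w) = 0` pointwise leaves `η^R` invariant. -/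
theorem fderiv_etaR_eq_etaR_lieVF {n : ℕ} {X Y : Heis n → Heis n} {p : Heis n}
    {L : Heis n →L[ℝ] Heis n} (hX : HasFDerivAt X L p)
    (hL : ∀ w, etaR p (L w) = ∑ i, (X p).2.1 i * w.1 i) (hY : DifferentiableAt ℝ Y p) :
    fderiv ℝ (fun q => etaR q (Y q)) p (X p) = etaR p (lieVF X Y p) := by
  have hsub (v w : Heis n) : etaR p (v - w) = etaR p v - etaR p w := by
    simp [etaR, mul_sub]
    ring
  rw [fderiv_etaR_apply hY, lieVF, hX.fderiv, hsub, hL]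

/-- Each of `ξ, R_i, S_i, X_{ij} (i ≤ j), Y_{ij} (i < j)` leaves the contact form `η^R`
invariant: `X(η^R(Y)) = η^R([X,Y])` for all smooth vector fields `Y`, i.e., `£_X η^R = 0`. -/
theorem stmt6 (n : ℕ) :
    ∀ X ∈ sasGens n, ∀ Y : Heis n → Heis n, ContDiff ℝ (⊤ : ℕ∞) Y → ∀ p : Heis n,
      fderiv ℝ (fun q => etaR q (Y q)) p (X p) = etaR p (lieVF X Y p) := by
  intro X hX Y hY p
  have hYp : DifferentiableAt ℝ Y p := (hY.differentiable (by simp)).differentiableAt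
  have hx := fun i => Heis.hasFDerivAt_x (n := n) i p
  have hy := fun i => Heis.hasFDerivAt_y (n := n) i p
  rcases hX with (((rfl | ⟨i, rfl⟩) | ⟨i, rfl⟩) | ⟨i, j, -, rfl⟩) | ⟨i, j, -, rfl⟩
  · have h : HasFDerivAt (xiVF (n := n)) _ p := hasFDerivAt_const (𝕜 := ℝ) _ p
    exact fderiv_etaR_eq_etaR_lieVF h (by simp [etaR, xiVF]) hYp
  · have h : HasFDerivAt (Rf i) _ p := hasFDerivAt_const (𝕜 := ℝ) _ p
    exact fderiv_etaR_eq_etaR_lieVF h (by simp [etaR, Rf]) hYp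
  · have h : HasFDerivAt (Sf i) _ p :=
      (hasFDerivAt_const (0 : Fin n → ℝ) p).prodMk
        ((hasFDerivAt_const (Pi.single i 1 : Fin n → ℝ) p).prodMk (hx i))
    exact fderiv_etaR_eq_etaR_lieVF h (by simp [etaR, Sf, Pi.single_apply]) hYp
  · have h : HasFDerivAt (Xf i j) _ p :=
      (hasFDerivAt_pi.2 fun k =>
        ((hy i).mul_const (if k = j then (1 : ℝ) else 0)).neg.sub
          ((hy j).mul_const (if k = i then (1 : ℝ) else 0))).prodMk
      ((hasFDerivAt_pi.2 fun k =>
        ((hx i).mul_const (if k = j then (1 : ℝ) else 0)).add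
          ((hx j).mul_const (if k = i then (1 : ℝ) else 0))).prodMk
      (((hx i).mul (hx j)).sub ((hy i).mul (hy j))))
    refine fderiv_etaR_eq_etaR_lieVF h (fun w => ?_) hYp
    simp [-ite_smul, etaR, Xf, mul_sub, add_mul, Finset.sum_add_distrib]
    ring
  · have h : HasFDerivAt (Yf i j) _ p :=
      (hasFDerivAt_pi.2 fun k =>
        ((hx i).mul_const (if k = j then (1 : ℝ) else 0)).sub
          ((hx j).mul_const (if k = i then (1 : ℝ) else 0))).prodMk
      ((hasFDerivAt_pi.2 fun k =>
        ((hy i).mul_const (if k = j then (1 : ℝ) else 0)).sub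
          ((hy j).mul_const (if k = i then (1 : ℝ) else 0))).prodMk
      (hasFDerivAt_const (0 : ℝ) p))
    refine fderiv_etaR_eq_etaR_lieVF h (fun w => ?_) hYp
    simp [-ite_smul, etaR, Yf, mul_sub, sub_mul]
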